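/- Let (C, ⊗, 1) be a symmetric monoidal category that is ℚ-linear (Hom-sets are ℚ-vector spaces, composition and the tensor product of morphisms are ℚ-bilinear) and idempotent complete. For an object A and n ≥ 1, the symmetric group Σ_n acts on A^{⊗n} by permuting factors via the braiding, and the averaging endomorphism e_A = (1/n!) Σ_{σ ∈ Σ_n} σ of A^{⊗n} is idempotent; define the n-th symmetric power S^n(A) as the image of e_A. Let L be a ⊗-invertible object of C such that the braiding L ⊗ L → L ⊗ L is the identity. Then for every object A and every n ≥ 1 there is an isomorphism S^n(A ⊗ L) ≅ S^n(A) ⊗ L^{⊗n}. -/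

import Mathlib

open CategoryTheory CategoryTheory.MonoidalCategory

universe v u

namespace Stmt12

variable {C : Type u} [Category.{v} C]

/-- Left-nested tensor powers `A^{⊗n}` of an object of a monoidal category. -/
def tpow [MonoidalCategory C] (A : C) : ℕ → C
  | 0 => 𝟙_ C
  | n + 1 => tpow A n ⊗ A

/-- The extension of a permutation of `Fin n` to a permutation of `Fin (n + 1)` fixing the
last element. -/
noncomputable def castPerm {n : ℕ} (σ : Equiv.Perm (Fin n)) : Equiv.Perm (Fin (n + 1)) :=
  letI := Classical.decPred (· ∈ Set.range (Fin.castSucc : Fin n → Fin (n + 1)))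
  σ.extendDomain (Equiv.ofInjective _ (Fin.castSucc_injective n))

theorem castPerm_castSucc {n : ℕ} (σ : Equiv.Perm (Fin n)) (i : Fin n) :
    castPerm σ i.castSucc = (σ i).castSucc := by
  let := Classical.decPred (· ∈ Set.range (Fin.castSucc : Fin n → Fin (n + 1)))
  exact Equiv.Perm.extendDomain_apply_image σ (Equiv.ofInjective _ (Fin.castSucc_injective n)) i

theorem castPerm_last {n : ℕ} (σ : Equiv.Perm (Fin n)) :
    castPerm σ (Fin.last n) = Fin.last n := by
  let := Classical.decPred (· ∈ Set.range (Fin.castSucc : Fin n → Fin (n + 1)))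
  refine Equiv.Perm.extendDomain_apply_not_subtype σ
    (Equiv.ofInjective _ (Fin.castSucc_injective n)) ?_
  rintro ⟨i, hi⟩
  exact Fin.castSucc_ne_last i hi

theorem castPerm_swap {n : ℕ} (i j : Fin n) :
    castPerm (Equiv.swap i j) = Equiv.swap i.castSucc j.castSucc := by
  ext k : 1
  induction k using Fin.lastCases with
  | last =>
    rw [castPerm_last, Equiv.swap_apply_of_ne_of_ne (Fin.castSucc_ne_last i).symm
      (Fin.castSucc_ne_last j).symm]
  | cast k =>
    rw [castPerm_castSucc, Equiv.swap_apply_def, Equiv.swap_apply_def]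
    simp only [Fin.castSucc_inj]
    split_ifs <;> rfl

/-- A submonoid of the permutations of `Fin (n + 2)` containing the extended permutations and
the last adjacent transposition is everything. -/
theorem submonoid_eq_top {n : ℕ} (M : Submonoid (Equiv.Perm (Fin (n + 2))))
    (hM : ∀ σ : Equiv.Perm (Fin (n + 1)), castPerm σ ∈ M)
    (hlast : Equiv.swap (Fin.castSucc (Fin.last n)) (Fin.last (n + 1)) ∈ M) : M = ⊤ := by
  rw [eq_top_iff, ← Equiv.Perm.mclosure_swap_castSucc_succ, Submonoid.closure_le]
  rintro _ ⟨i, rfl⟩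
  induction i using Fin.lastCases with
  | last => exact hlast
  | cast i =>
    have h := hM (Equiv.swap i.castSucc i.succ)
    rw [castPerm_swap] at h
    exact h

/-- In a symmetric monoidal category, the interchange `tensorμ` is compatible with braidings. -/
theorem braiding_tensorμ [MonoidalCategory C] [SymmetricCategory C] (X₁ X₂ Y₁ Y₂ : C) :
    (β_ (X₁ ⊗ X₂) (Y₁ ⊗ Y₂)).hom ≫ tensorμ Y₁ Y₂ X₁ X₂ =
      tensorμ X₁ X₂ Y₁ Y₂ ≫ ((β_ X₁ Y₁).hom ⊗ₘ (β_ X₂ Y₂).hom) := by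
  simp only [tensorμ, BraidedCategory.braiding_tensor_left_hom,
    BraidedCategory.braiding_tensor_right_hom, MonoidalCategory.tensorHom_def]
  calc
    _ = 𝟙 _ ⊗≫ X₁ ◁ (β_ X₂ Y₁).hom ▷ Y₂ ⊗≫
          (β_ X₁ Y₁).hom ▷ (X₂ ⊗ Y₂) ⊗≫ (Y₁ ⊗ X₁) ◁ (β_ X₂ Y₂).hom ⊗≫
          Y₁ ◁ ((β_ X₁ Y₂).hom ≫ (β_ Y₂ X₁).hom) ▷ X₂ ⊗≫ 𝟙 _ := by monoidal
    _ = _ := by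
      rw [SymmetricCategory.symmetry]
      monoidal

/-- The canonical isomorphism `(A ⊗ B)^{⊗n} ≅ A^{⊗n} ⊗ B^{⊗n}`. -/
def tpowTensorIso [MonoidalCategory C] [BraidedCategory C] (A B : C) :
    ∀ n : ℕ, tpow (A ⊗ B) n ≅ tpow A n ⊗ tpow B n
  | 0 => (λ_ (𝟙_ C)).symm
  | n + 1 => whiskerRightIso (tpowTensorIso A B n) (A ⊗ B) ≪≫
      ⟨tensorμ (tpow A n) (tpow B n) A B, tensorδ (tpow A n) (tpow B n) A B,
        tensorμ_tensorδ _ _ _ _, tensorδ_tensorμ _ _ _ _⟩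

section Intertwining

variable [MonoidalCategory C]

theorem whiskerRight_comp_tensorμ [BraidedCategory C] {T X Y : C} {f : T ⟶ T} {d : T ⟶ X ⊗ Y}
    {g : X ⟶ X} (h : f ≫ d = d ≫ g ▷ Y) (A B : C) :
    f ▷ (A ⊗ B) ≫ d ▷ (A ⊗ B) ≫ tensorμ X Y A B =
      (d ▷ (A ⊗ B) ≫ tensorμ X Y A B) ≫ g ▷ A ▷ (Y ⊗ B) := by
  rw [← comp_whiskerRight_assoc, h, comp_whiskerRight, Category.assoc, Category.assoc,
    ← tensorHom_id g, tensorμ_natural_left]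
  simp

theorem whiskerRight_tensorμ_twice [BraidedCategory C] {T X Y : C} (d : T ⟶ X ⊗ Y) (A B : C) :
    (d ▷ (A ⊗ B) ≫ tensorμ X Y A B) ▷ (A ⊗ B) ≫ tensorμ (X ⊗ A) (Y ⊗ B) A B =
      (α_ T (A ⊗ B) (A ⊗ B)).hom ≫ (d ⊗ₘ tensorμ A B A B) ≫
        tensorμ X Y (A ⊗ A) (B ⊗ B) ≫ ((α_ X A A).inv ⊗ₘ (α_ Y B B).inv) := by
  have h := tensor_associativity X Y A B A B
  rw [MonoidalCategory.tensorHom_def d, comp_whiskerRight, Category.assoc, Category.assoc,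
    ← associator_naturality_left_assoc, ← reassoc_of% h]
  simp [tensorHom_comp_tensorHom]

theorem braiding_comp_whiskerRight_tensorμ_twice [SymmetricCategory C] {T X Y : C}
    (d : T ⟶ X ⊗ Y) (A : C) {L : C} (hβL : (β_ L L).hom = 𝟙 (L ⊗ L)) :
    ((α_ T (A ⊗ L) (A ⊗ L)).hom ≫ (T ◁ (β_ (A ⊗ L) (A ⊗ L)).hom) ≫
        (α_ T (A ⊗ L) (A ⊗ L)).inv) ≫
          (d ▷ (A ⊗ L) ≫ tensorμ X Y A L) ▷ (A ⊗ L) ≫ tensorμ (X ⊗ A) (Y ⊗ L) A L =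
      ((d ▷ (A ⊗ L) ≫ tensorμ X Y A L) ▷ (A ⊗ L) ≫ tensorμ (X ⊗ A) (Y ⊗ L) A L) ≫
        ((α_ X A A).hom ≫ (X ◁ (β_ A A).hom) ≫ (α_ X A A).inv) ▷ ((Y ⊗ L) ⊗ L) := by
  have h : T ◁ (β_ (A ⊗ L) (A ⊗ L)).hom ≫ (d ⊗ₘ tensorμ A L A L) =
      (d ⊗ₘ tensorμ A L A L) ≫ (X ⊗ Y) ◁ ((β_ A A).hom ⊗ₘ 𝟙 (L ⊗ L)) := by
    rw [← id_tensorHom, ← id_tensorHom, tensorHom_comp_tensorHom, tensorHom_comp_tensorHom,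
      braiding_tensorμ, hβL, Category.id_comp, Category.comp_id]
  rw [whiskerRight_tensorμ_twice]
  simp only [Category.assoc, Iso.inv_hom_id_assoc]
  rw [reassoc_of% h, tensorμ_natural_right_assoc, ← tensorHom_id ((α_ X A A).hom ≫ _)]
  simp only [tensorHom_comp_tensorHom, whiskerLeft_id, Category.id_comp, Category.comp_id,
    Iso.inv_hom_id_assoc]

end Intertwining

section Action

variable [MonoidalCategory C] [SymmetricCategory C]
  (ρ : ∀ (A : C) (n : ℕ), Equiv.Perm (Fin n) →* Aut (tpow A n))

/-- If the self-braiding of `L` is trivial, then `tpowTensorIso A L n` intertwines the action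
of the symmetric group on `(A ⊗ L)^{⊗n}` with its action on the factor `A^{⊗n}`. -/
theorem action_comp_tpowTensorIso
    (hcast : ∀ (A : C) (n : ℕ) (σ : Equiv.Perm (Fin n)),
      (ρ A (n + 1) (castPerm σ)).hom = (ρ A n σ).hom ▷ A)
    (hswap : ∀ (A : C) (n : ℕ),
      (ρ A (n + 2) (Equiv.swap (Fin.castSucc (Fin.last n)) (Fin.last (n + 1)))).hom =
        (α_ (tpow A n) A A).hom ≫ (tpow A n ◁ (β_ A A).hom) ≫ (α_ (tpow A n) A A).inv)
    {L : C} (hβL : (β_ L L).hom = 𝟙 (L ⊗ L)) (A : C) :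
    ∀ (n : ℕ) (σ : Equiv.Perm (Fin n)),
      (ρ (A ⊗ L) n σ).hom ≫ (tpowTensorIso A L n).hom =
        (tpowTensorIso A L n).hom ≫ (ρ A n σ).hom ▷ tpow L n
  | 0, σ | 1, σ => by
    rw [Subsingleton.elim σ 1, map_one, map_one]
    change 𝟙 _ ≫ _ = _ ≫ 𝟙 _ ▷ _
    simp
  | n + 2, σ => by
    let M : Submonoid (Equiv.Perm (Fin (n + 2))) :=
      { carrier := {σ | (ρ (A ⊗ L) (n + 2) σ).hom ≫ (tpowTensorIso A L (n + 2)).hom =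
          (tpowTensorIso A L (n + 2)).hom ≫ (ρ A (n + 2) σ).hom ▷ tpow L (n + 2)}
        one_mem' := by
          simp only [Set.mem_ofPred_eq, map_one]
          change 𝟙 _ ≫ _ = _ ≫ 𝟙 _ ▷ _
          simp
        mul_mem' := by
          intro σ τ hσ hτ
          simp only [Set.mem_ofPred_eq, map_mul] at hσ hτ ⊢
          change (_ ≫ _) ≫ _ = _ ≫ (_ ≫ _) ▷ _
          rw [Category.assoc, hσ, reassoc_of% hτ, comp_whiskerRight] }
    suffices hM : M = ⊤ from (hM ▸ Submonoid.mem_top σ : σ ∈ M)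
    refine submonoid_eq_top M (fun τ => ?_) ?_
    · change (ρ (A ⊗ L) (n + 2) (castPerm τ)).hom ≫ _ = _ ≫ (ρ A (n + 2) (castPerm τ)).hom ▷ _
      rw [hcast, hcast]
      exact whiskerRight_comp_tensorμ
        (action_comp_tpowTensorIso hcast hswap hβL A (n + 1) τ) A L
    · change (ρ (A ⊗ L) (n + 2) _).hom ≫ _ = _ ≫ (ρ A (n + 2) _).hom ▷ _
      rw [hswap, hswap]
      exact braiding_comp_whiskerRight_tensorμ_twice (tpowTensorIso A L n).hom A hβL

end Action

/-- The averaging endomorphism of an action of a finite group is idempotent. -/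
theorem average_comp_average [Preadditive C] [CategoryTheory.Linear ℚ C] {G : Type*} [Group G]
    [Fintype G] {X : C} (ρ : G →* Aut X) (c : ℚ) (hc : c * Fintype.card G = 1) :
    (c • ∑ g, (ρ g).hom) ≫ (c • ∑ g, (ρ g).hom) = c • ∑ g, (ρ g).hom := by
  have h (g : G) : (ρ g).hom ≫ ∑ k, (ρ k).hom = ∑ k, (ρ k).hom := by
    rw [Preadditive.comp_sum, ← Equiv.sum_comp (Equiv.mulRight g) fun k => (ρ k).hom]
    refine Finset.sum_congr rfl fun k _ => ?_
    rw [Equiv.coe_mulRight, map_mul]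
    rfl
  rw [Linear.smul_comp, Linear.comp_smul, Preadditive.sum_comp, Finset.sum_congr rfl fun g _ => h g,
    Finset.sum_const, Finset.card_univ, ← Nat.cast_smul_eq_nsmul ℚ, smul_smul c (Fintype.card G : ℚ),
    hc, one_smul]

/-- Let `C` be a symmetric monoidal, ℚ-linear, idempotent complete
category, and let `ρ` be the canonical action of the symmetric groups on tensor powers
(characterized by its values on the extensions of permutations and on the last adjacent
transposition, which acts by the braiding).  For each object `A`, the averaging
endomorphisms of `A^{⊗n}` are idempotent and `Sⁿ(A)` is defined as the image of the
averaging idempotent (a splitting, using idempotent completeness).  If `L` is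
`⊗`-invertible and its self-braiding is the identity, then `Sⁿ(A ⊗ L) ≅ Sⁿ(A) ⊗ L^{⊗n}`. -/
theorem stmt_12 [MonoidalCategory C] [SymmetricCategory C]
    [Preadditive C] [CategoryTheory.Linear ℚ C] [MonoidalPreadditive C]
    [MonoidalLinear ℚ C] [IsIdempotentComplete C]
    (ρ : ∀ (A : C) (n : ℕ), Equiv.Perm (Fin n) →* Aut (tpow A n))
    (hcast : ∀ (A : C) (n : ℕ) (σ : Equiv.Perm (Fin n)),
      (ρ A (n + 1) (castPerm σ)).hom = (ρ A n σ).hom ▷ A)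
    (hswap : ∀ (A : C) (n : ℕ),
      (ρ A (n + 2) (Equiv.swap (Fin.castSucc (Fin.last n)) (Fin.last (n + 1)))).hom =
        (α_ (tpow A n) A A).hom ≫ (tpow A n ◁ (β_ A A).hom) ≫ (α_ (tpow A n) A A).inv)
    (L : C) (hL : ∃ L' : C, Nonempty (L ⊗ L' ≅ 𝟙_ C))
    (hβL : (β_ L L).hom = 𝟙 (L ⊗ L))
    (A : C) (n : ℕ) (hn : 1 ≤ n) :
    let e₁ : tpow (A ⊗ L) n ⟶ tpow (A ⊗ L) n :=
      (n.factorial : ℚ)⁻¹ • ∑ σ : Equiv.Perm (Fin n), (ρ (A ⊗ L) n σ).hom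
    let e₂ : tpow A n ⟶ tpow A n :=
      (n.factorial : ℚ)⁻¹ • ∑ σ : Equiv.Perm (Fin n), (ρ A n σ).hom
    (e₁ ≫ e₁ = e₁) ∧ (e₂ ≫ e₂ = e₂) ∧
    ∀ (S₁ S₂ : C) (i₁ : S₁ ⟶ tpow (A ⊗ L) n) (r₁ : tpow (A ⊗ L) n ⟶ S₁)
      (i₂ : S₂ ⟶ tpow A n) (r₂ : tpow A n ⟶ S₂),
      i₁ ≫ r₁ = 𝟙 S₁ → r₁ ≫ i₁ = e₁ →
      i₂ ≫ r₂ = 𝟙 S₂ → r₂ ≫ i₂ = e₂ →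
      Nonempty (S₁ ≅ S₂ ⊗ tpow L n) := by
  intro e₁ e₂
  have hc : (n.factorial : ℚ)⁻¹ * Fintype.card (Equiv.Perm (Fin n)) = 1 := by
    rw [Fintype.card_perm, Fintype.card_fin]
    exact inv_mul_cancel₀ (Nat.cast_ne_zero.mpr n.factorial_ne_zero)
  refine ⟨average_comp_average _ _ hc, average_comp_average _ _ hc, ?_⟩
  intro S₁ S₂ i₁ r₁ i₂ r₂ h₁ h₁' h₂ h₂'
  have he : e₁ ≫ (tpowTensorIso A L n).hom = (tpowTensorIso A L n).hom ≫ e₂ ▷ tpow L n := by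
    simp only [e₁, e₂, Linear.smul_comp, Preadditive.sum_comp, MonoidalLinear.smul_whiskerRight,
      sum_whiskerRight, Linear.comp_smul, Preadditive.comp_sum,
      action_comp_tpowTensorIso ρ hcast hswap hβL]
  have hi : i₁ ≫ e₁ = i₁ := by rw [← h₁', reassoc_of% h₁]
  have hr : e₂ ≫ r₂ = r₂ := by rw [← h₂', Category.assoc, h₂, Category.comp_id]
  refine ⟨⟨i₁ ≫ (tpowTensorIso A L n).hom ≫ r₂ ▷ tpow L n,
    i₂ ▷ tpow L n ≫ (tpowTensorIso A L n).inv ≫ r₁, ?_, ?_⟩⟩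
  · simp only [Category.assoc]
    rw [← comp_whiskerRight_assoc, h₂', ← reassoc_of% he, Iso.hom_inv_id_assoc, reassoc_of% hi, h₁]
  · simp only [Category.assoc]
    rw [reassoc_of% h₁', reassoc_of% he, Iso.inv_hom_id_assoc, ← comp_whiskerRight, hr,
      ← comp_whiskerRight, h₂, id_whiskerRight]

end Stmt12
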